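/- Let α ≥ 0 be an admissible exponent of A with associated sequence (M_n), and suppose G_α is invertible on c00(α) with c_α := ‖G_α^{−1}‖ > 0. Then for every k ∈ ℕ and all m > n in ℕ, ‖A(m,n)‖ ≤ [c_α(e^α − 1) + 1] · (c_α^k · k!)/(m − n)^k · M_n. -/

import Mathlib

open Filter Topology

variable {E : Type*} [NormedAddCommGroup E] [NormedSpace ℝ E] [CompleteSpace E]

/-- `evol A n m` is the evolution operator `A(m,n) = A_{m-1} ∘ ⋯ ∘ A_n`
(the identity if `m ≤ n`). -/
def evol (A : ℕ → E →L[ℝ] E) (n : ℕ) : ℕ → E →L[ℝ] E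
  | 0 => 1
  | m + 1 => if n ≤ m then A m * evol A n m else 1

/-- `α` is an admissible exponent for `A`: there is a positive sequence `M` with
`‖A(m,n)‖ ≤ M n * e^{α (m - n)}` for all `m ≥ n`. -/
def IsAdmissible (A : ℕ → E →L[ℝ] E) (α : ℝ) : Prop :=
  ∃ M : ℕ → ℝ, (∀ n, 0 < M n) ∧
    ∀ m n : ℕ, n ≤ m → ‖evol A n m‖ ≤ M n * Real.exp (α * ((m : ℝ) - (n : ℝ)))

/-- The norm `‖x‖_{n,α} = sup_{m ≥ n} e^{-α(m-n)} ‖A(m,n) x‖`. -/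
noncomputable def nnorm (A : ℕ → E →L[ℝ] E) (α : ℝ) (n : ℕ) (x : E) : ℝ :=
  ⨆ m : Set.Ici n, Real.exp (-α * (((m : ℕ) : ℝ) - (n : ℝ))) * ‖evol A n (m : ℕ) x‖

/-- Membership in `c00(α)`: `u 0 = 0` and `‖u n‖_{n,α} → 0`. -/
def MemC00 (A : ℕ → E →L[ℝ] E) (α : ℝ) (u : ℕ → E) : Prop :=
  u 0 = 0 ∧ Tendsto (fun n => nnorm A α n (u n)) atTop (𝓝 0)

/-- The norm `‖u‖_α = sup_n ‖u n‖_{n,α}` on `c00(α)`. -/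
noncomputable def cnorm (A : ℕ → E →L[ℝ] E) (α : ℝ) (u : ℕ → E) : ℝ :=
  ⨆ n, nnorm A α n (u n)

/-- The evolution map `T`: `(Tu)_0 = 0`, `(Tu)_{n+1} = A_n u_n`. -/
def Tmap (A : ℕ → E →L[ℝ] E) (u : ℕ → E) : ℕ → E
  | 0 => 0
  | m + 1 => A m (u m)

/-- `G = T - Id`. -/
def Gmap (A : ℕ → E →L[ℝ] E) (u : ℕ → E) : ℕ → E :=
  fun n => Tmap A u n - u n

section

variable {F : Type*} [NormedAddCommGroup F] [NormedSpace ℝ F]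

theorem evol_self (A : ℕ → F →L[ℝ] F) (n : ℕ) : evol A n n = 1 := by
  cases n <;> simp [evol]

theorem evol_succ (A : ℕ → F →L[ℝ] F) {n m : ℕ} (h : n ≤ m) :
    evol A n (m + 1) = A m * evol A n m := by
  simp [evol, h]

theorem evol_mul_evol (A : ℕ → F →L[ℝ] F) {n j m : ℕ} (hnj : n ≤ j) (hjm : j ≤ m) :
    evol A j m * evol A n j = evol A n m := by
  induction m, hjm using Nat.le_induction with
  | base => simp [evol_self]
  | succ m hm ih => rw [evol_succ A hm, evol_succ A (hnj.trans hm), mul_assoc, ih]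

theorem nnorm_nonneg' (A : ℕ → F →L[ℝ] F) (α : ℝ) (n : ℕ) (x : F) : 0 ≤ nnorm A α n x :=
  Real.iSup_nonneg fun _ => by positivity

theorem nnorm_smul' (A : ℕ → F →L[ℝ] F) (α : ℝ) (n : ℕ) (r : ℝ) (x : F) :
    nnorm A α n (r • x) = |r| * nnorm A α n x := by
  simp only [nnorm, Real.mul_iSup_of_nonneg (abs_nonneg r), map_smul, norm_smul, Real.norm_eq_abs]
  congr 1
  ext m
  ring

section Bounded

variable {A : ℕ → F →L[ℝ] F} {α : ℝ} {M : ℕ → ℝ}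

theorem exp_mul_norm_evol_le
    (hbd : ∀ m n : ℕ, n ≤ m → ‖evol A n m‖ ≤ M n * Real.exp (α * ((m : ℝ) - (n : ℝ))))
    {n m : ℕ} (h : n ≤ m) (x : F) :
    Real.exp (-α * ((m : ℝ) - (n : ℝ))) * ‖evol A n m x‖ ≤ M n * ‖x‖ := by
  have h1 : ‖evol A n m x‖ ≤ M n * Real.exp (α * ((m : ℝ) - (n : ℝ))) * ‖x‖ :=
    (evol A n m).le_of_opNorm_le (hbd m n h) x
  calc _ ≤ Real.exp (-α * ((m : ℝ) - (n : ℝ))) *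
        (M n * Real.exp (α * ((m : ℝ) - (n : ℝ))) * ‖x‖) := by gcongr
    _ = (Real.exp (-α * ((m : ℝ) - (n : ℝ))) * Real.exp (α * ((m : ℝ) - (n : ℝ)))) *
        (M n * ‖x‖) := by ring
    _ = M n * ‖x‖ := by rw [← Real.exp_add]; simp

theorem nnorm_le
    (hbd : ∀ m n : ℕ, n ≤ m → ‖evol A n m‖ ≤ M n * Real.exp (α * ((m : ℝ) - (n : ℝ))))
    (n : ℕ) (x : F) : nnorm A α n x ≤ M n * ‖x‖ :=
  ciSup_le fun m => exp_mul_norm_evol_le hbd m.2 x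

theorem le_nnorm
    (hbd : ∀ m n : ℕ, n ≤ m → ‖evol A n m‖ ≤ M n * Real.exp (α * ((m : ℝ) - (n : ℝ))))
    {n m : ℕ} (h : n ≤ m) (x : F) :
    Real.exp (-α * ((m : ℝ) - (n : ℝ))) * ‖evol A n m x‖ ≤ nnorm A α n x :=
  le_ciSup (f := fun m : Set.Ici n =>
      Real.exp (-α * (((m : ℕ) : ℝ) - (n : ℝ))) * ‖evol A n (m : ℕ) x‖)
    ⟨M n * ‖x‖, by rintro _ ⟨m, rfl⟩; exact exp_mul_norm_evol_le hbd m.2 x⟩ ⟨m, h⟩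

theorem norm_le_nnorm
    (hbd : ∀ m n : ℕ, n ≤ m → ‖evol A n m‖ ≤ M n * Real.exp (α * ((m : ℝ) - (n : ℝ))))
    (n : ℕ) (x : F) : ‖x‖ ≤ nnorm A α n x := by
  simpa [evol_self] using le_nnorm hbd le_rfl x

theorem exp_mul_nnorm_evol_le
    (hbd : ∀ m n : ℕ, n ≤ m → ‖evol A n m‖ ≤ M n * Real.exp (α * ((m : ℝ) - (n : ℝ))))
    {n j : ℕ} (h : n ≤ j) (x : F) :
    Real.exp (-α * ((j : ℝ) - (n : ℝ))) * nnorm A α j (evol A n j x) ≤ nnorm A α n x := by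
  rw [nnorm, Real.mul_iSup_of_nonneg (Real.exp_nonneg _)]
  refine ciSup_le fun m => ?_
  have hjm : j ≤ (m : ℕ) := m.2
  have h1 := le_nnorm hbd (h.trans hjm) x
  rw [← evol_mul_evol A h hjm] at h1
  rwa [← mul_assoc, ← Real.exp_add, show -α * ((j : ℝ) - n) + -α * (((m : ℕ) : ℝ) - j) =
    -α * (((m : ℕ) : ℝ) - n) by ring]

end Bounded

theorem MemC00.nnorm_le_cnorm {A : ℕ → F →L[ℝ] F} {α : ℝ} {u : ℕ → F} (hu : MemC00 A α u)
    (j : ℕ) : nnorm A α j (u j) ≤ cnorm A α u :=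
  le_ciSup (f := fun n => nnorm A α n (u n)) hu.2.bddAbove_range j

/-- The orbit of `x` started at time `n`, with weight `f i` after `i` steps. -/
def weightedOrbit (A : ℕ → F →L[ℝ] F) (n : ℕ) (x : F) (f : ℕ → ℝ) (j : ℕ) : F :=
  f (j - n) • evol A n j x

theorem nnorm_weightedOrbit (A : ℕ → F →L[ℝ] F) (α : ℝ) (n : ℕ) (x : F) (f : ℕ → ℝ) (j : ℕ) :
    nnorm A α j (weightedOrbit A n x f j) = |f (j - n)| * nnorm A α j (evol A n j x) :=
  nnorm_smul' ..

theorem Gmap_weightedOrbit (A : ℕ → F →L[ℝ] F) (n : ℕ) (x : F) {f g : ℕ → ℝ} (hf : f 0 = 0)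
    (hg : g 0 = 0) (hgf : ∀ i, g (i + 1) = g i + f (i + 1)) :
    Gmap A (weightedOrbit A n x g) = weightedOrbit A n x (-f) := by
  funext j
  cases j with
  | zero => simp [Gmap, Tmap, weightedOrbit, hf, hg]
  | succ j =>
    rcases le_or_gt n j with h | h
    · simp [Gmap, Tmap, weightedOrbit, evol_succ A h, Nat.succ_sub h, hgf, add_smul]
    · simp [Gmap, Tmap, weightedOrbit, Nat.sub_eq_zero_of_le h.le,
        Nat.sub_eq_zero_of_le (Nat.succ_le_of_lt h), hf, hg]

theorem Gmap_injective (A : ℕ → F →L[ℝ] F) {u v : ℕ → F} (h0 : u 0 = v 0)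
    (h : Gmap A u = Gmap A v) : u = v := by
  funext j
  induction j with
  | zero => exact h0
  | succ j ih => simpa [Gmap, Tmap, ih] using congrFun h (j + 1)

theorem MemC00.weightedOrbit_mono {A : ℕ → F →L[ℝ] F} {α : ℝ} {n : ℕ} {x : F} {f g : ℕ → ℝ}
    (hf : MemC00 A α (weightedOrbit A n x f)) (hg : g 0 = 0) (hgf : ∀ i, |g i| ≤ |f i|) :
    MemC00 A α (weightedOrbit A n x g) := by
  refine ⟨by simp [weightedOrbit, hg], squeeze_zero (fun _ => nnorm_nonneg' ..) (fun j => ?_) hf.2⟩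
  rw [nnorm_weightedOrbit, nnorm_weightedOrbit]
  exact mul_le_mul_of_nonneg_right (hgf _) (nnorm_nonneg' ..)

theorem cnorm_weightedOrbit_neg (A : ℕ → F →L[ℝ] F) (α : ℝ) (n : ℕ) (x : F) (f : ℕ → ℝ) :
    cnorm A α (weightedOrbit A n x (-f)) = cnorm A α (weightedOrbit A n x f) := by
  simp [cnorm, nnorm_weightedOrbit]

theorem MemC00.weightedOrbit_sum {A : ℕ → F →L[ℝ] F} {α : ℝ} {n : ℕ} {x : F} {f g : ℕ → ℝ}
    (hsurj : ∀ v, MemC00 A α v → ∃ u, MemC00 A α u ∧ Gmap A u = v)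
    (hf : MemC00 A α (weightedOrbit A n x f)) (hf0 : f 0 = 0)
    (hg : g 0 = 0) (hgf : ∀ i, g (i + 1) = g i + f (i + 1)) :
    MemC00 A α (weightedOrbit A n x g) := by
  obtain ⟨u, hu, hGu⟩ := hsurj (weightedOrbit A n x (-f))
    (hf.weightedOrbit_mono (by simp [hf0]) (by simp))
  rw [← Gmap_weightedOrbit A n x hf0 hg hgf] at hGu
  rwa [← Gmap_injective A (by simp [hu.1, weightedOrbit, hg]) hGu]

theorem cnorm_weightedOrbit_le {A : ℕ → F →L[ℝ] F} {α c : ℝ} {n : ℕ} {x : F} {f g : ℕ → ℝ}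
    (hinv : ∀ u, MemC00 A α u → cnorm A α u ≤ c * cnorm A α (Gmap A u))
    (hmem : MemC00 A α (weightedOrbit A n x g)) (hf0 : f 0 = 0)
    (hg : g 0 = 0) (hgf : ∀ i, g (i + 1) = g i + f (i + 1)) :
    cnorm A α (weightedOrbit A n x g) ≤ c * cnorm A α (weightedOrbit A n x f) := by
  simpa only [Gmap_weightedOrbit A n x hf0 hg hgf, cnorm_weightedOrbit_neg] using hinv _ hmem

/-- The weights obtained from the indicator of `i ≥ 1` by summing `k` times. -/
def multichooseWeight (k i : ℕ) : ℝ := if i = 0 then 0 else (Nat.multichoose i k : ℝ)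

theorem multichooseWeight_zero_right (k : ℕ) : multichooseWeight k 0 = 0 := by
  simp [multichooseWeight]

theorem multichooseWeight_succ (k i : ℕ) :
    multichooseWeight (k + 1) (i + 1) =
      multichooseWeight (k + 1) i + multichooseWeight k (i + 1) := by
  cases i with
  | zero => simp [multichooseWeight]
  | succ i => simp [multichooseWeight, Nat.multichoose_succ_succ (i + 1) k]

theorem pow_le_factorial_mul_multichooseWeight (k : ℕ) {i : ℕ} (hi : i ≠ 0) :
    (i : ℝ) ^ k ≤ k.factorial * multichooseWeight k i := by
  rw [multichooseWeight, if_neg hi, Nat.multichoose_eq]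
  have h := Nat.ascFactorial_eq_factorial_mul_choose' i k
  have h2 := Nat.pow_succ_le_ascFactorial i k
  rw [h] at h2
  exact_mod_cast h2

theorem memC00_weightedOrbit_multichooseWeight {A : ℕ → F →L[ℝ] F} {α : ℝ}
    (hsurj : ∀ v, MemC00 A α v → ∃ u, MemC00 A α u ∧ Gmap A u = v) (n : ℕ) (x : F) (k : ℕ) :
    MemC00 A α (weightedOrbit A n x (multichooseWeight k)) := by
  induction k with
  | zero =>
    have hδ : MemC00 A α (weightedOrbit A n x (fun i => if i = 1 then 1 else 0)) := by
      refine ⟨by simp [weightedOrbit], tendsto_const_nhds.congr' ?_⟩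
      filter_upwards [eventually_gt_atTop (n + 1)] with j hj
      rw [nnorm_weightedOrbit, if_neg (by omega)]
      simp
    refine hδ.weightedOrbit_sum hsurj (by simp) (multichooseWeight_zero_right 0) fun i => ?_
    cases i <;> simp [multichooseWeight]
  | succ k ih =>
    exact ih.weightedOrbit_sum hsurj (multichooseWeight_zero_right k)
      (multichooseWeight_zero_right (k + 1)) (multichooseWeight_succ k)

theorem cnorm_weightedOrbit_multichooseWeight_zero_le {A : ℕ → F →L[ℝ] F} {α c : ℝ} {M : ℕ → ℝ}
    (hα0 : 0 ≤ α) (hc : 0 ≤ c)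
    (hbd : ∀ m n : ℕ, n ≤ m → ‖evol A n m‖ ≤ M n * Real.exp (α * ((m : ℝ) - (n : ℝ))))
    (hsurj : ∀ v, MemC00 A α v → ∃ u, MemC00 A α u ∧ Gmap A u = v)
    (hinv : ∀ u, MemC00 A α u → cnorm A α u ≤ c * cnorm A α (Gmap A u)) (n : ℕ) (x : F) :
    cnorm A α (weightedOrbit A n x (multichooseWeight 0)) ≤
      (c * (Real.exp α - 1) + 1) * nnorm A α n x := by
  have hexp : 0 ≤ Real.exp α - 1 := by simpa using hα0
  have hdecay (j : ℕ) (hj : n < j) :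
      Real.exp (-α * ((j - n : ℕ) : ℝ)) * nnorm A α j (evol A n j x) ≤ nnorm A α n x := by
    rw [Nat.cast_sub hj.le]
    exact exp_mul_nnorm_evol_le hbd hj.le x
  set f : ℕ → ℝ := fun i => if i = 0 then 0 else (Real.exp α - 1) * Real.exp (-α * i) with hf
  set g : ℕ → ℝ := fun i => 1 - Real.exp (-α * i) with hg
  have hle (i : ℕ) : Real.exp (-α * i) ≤ 1 :=
    Real.exp_le_one_iff.2 (by nlinarith [Nat.cast_nonneg (α := ℝ) i])
  have hg0 : g 0 = 0 := by simp [hg]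
  have hmem : MemC00 A α (weightedOrbit A n x g) := by
    refine (memC00_weightedOrbit_multichooseWeight hsurj n x 0).weightedOrbit_mono hg0 fun i => ?_
    rcases eq_or_ne i 0 with rfl | hi
    · simp [hg]
    · simp only [hg, multichooseWeight, if_neg hi, Nat.multichoose_zero_right, Nat.cast_one,
        abs_one]
      rw [abs_of_nonneg (sub_nonneg.2 (hle i))]
      linarith [Real.exp_pos (-α * i)]
  have hu : cnorm A α (weightedOrbit A n x g) ≤ c * ((Real.exp α - 1) * nnorm A α n x) := by
    refine (cnorm_weightedOrbit_le (f := f) hinv hmem (by simp [hf]) hg0 fun i => ?_).trans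
      (mul_le_mul_of_nonneg_left (ciSup_le fun j => ?_) hc)
    · have h : Real.exp α * Real.exp (-α * (i + 1 : ℕ)) = Real.exp (-α * i) := by
        rw [← Real.exp_add]
        congr 1
        push_cast
        ring
      simp only [hf, hg, Nat.succ_ne_zero, if_false]
      linarith
    · rw [nnorm_weightedOrbit]
      rcases le_or_gt j n with hj | hj
      · simpa [hf, Nat.sub_eq_zero_of_le hj] using mul_nonneg hexp (nnorm_nonneg' A α n x)
      · simp only [hf, if_neg (Nat.sub_ne_zero_of_lt hj)]
        rw [abs_of_nonneg (by positivity), mul_assoc]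
        exact mul_le_mul_of_nonneg_left (hdecay j hj) hexp
  refine ciSup_le fun j => ?_
  rw [nnorm_weightedOrbit]
  rcases le_or_gt j n with hj | hj
  · simpa [multichooseWeight, Nat.sub_eq_zero_of_le hj] using
      mul_nonneg (by positivity) (nnorm_nonneg' A α n x)
  · have h := (hmem.nnorm_le_cnorm j).trans hu
    rw [nnorm_weightedOrbit, abs_of_nonneg (sub_nonneg.2 (hle _))] at h
    simp only [multichooseWeight, if_neg (Nat.sub_ne_zero_of_lt hj), Nat.multichoose_zero_right,
      Nat.cast_one, abs_one]
    linarith [hdecay j hj]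

theorem cnorm_weightedOrbit_multichooseWeight_le {A : ℕ → F →L[ℝ] F} {α c : ℝ} {M : ℕ → ℝ}
    (hα0 : 0 ≤ α) (hc : 0 ≤ c)
    (hbd : ∀ m n : ℕ, n ≤ m → ‖evol A n m‖ ≤ M n * Real.exp (α * ((m : ℝ) - (n : ℝ))))
    (hsurj : ∀ v, MemC00 A α v → ∃ u, MemC00 A α u ∧ Gmap A u = v)
    (hinv : ∀ u, MemC00 A α u → cnorm A α u ≤ c * cnorm A α (Gmap A u))
    (n : ℕ) (x : F) (k : ℕ) :
    cnorm A α (weightedOrbit A n x (multichooseWeight k)) ≤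
      c ^ k * ((c * (Real.exp α - 1) + 1) * nnorm A α n x) := by
  induction k with
  | zero =>
    simpa using cnorm_weightedOrbit_multichooseWeight_zero_le hα0 hc hbd hsurj hinv n x
  | succ k ih =>
    calc _ ≤ c * cnorm A α (weightedOrbit A n x (multichooseWeight k)) :=
          cnorm_weightedOrbit_le hinv
            (memC00_weightedOrbit_multichooseWeight hsurj n x (k + 1))
            (multichooseWeight_zero_right k) (multichooseWeight_zero_right (k + 1))
            (multichooseWeight_succ k)
      _ ≤ c * (c ^ k * ((c * (Real.exp α - 1) + 1) * nnorm A α n x)) := by gcongr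
      _ = _ := by ring

end

/-- Under the hypotheses of Statement 4, for every `k ∈ ℕ` and `m > n`,
`‖A(m,n)‖ ≤ (c_α(e^α - 1) + 1) · c_α^k k! / (m-n)^k · M_n`. -/
theorem stmt5 (A : ℕ → E →L[ℝ] E) (α : ℝ) (hα0 : 0 ≤ α) (M : ℕ → ℝ)
    (hM : ∀ n, 0 < M n)
    (hbd : ∀ m n : ℕ, n ≤ m → ‖evol A n m‖ ≤ M n * Real.exp (α * ((m : ℝ) - (n : ℝ))))
    (c : ℝ) (hc : 0 < c)
    (hsurj : ∀ v, MemC00 A α v → ∃ u, MemC00 A α u ∧ Gmap A u = v)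
    (hinv : ∀ u, MemC00 A α u → cnorm A α u ≤ c * cnorm A α (Gmap A u)) :
    ∀ (k : ℕ) (m n : ℕ), n < m →
      ‖evol A n m‖ ≤
        (c * (Real.exp α - 1) + 1) * (c ^ k * (Nat.factorial k : ℝ)) /
          ((m : ℝ) - (n : ℝ)) ^ k * M n := by
  intro k m n hnm
  have hexp : 0 ≤ Real.exp α - 1 := by simpa using hα0
  have hd : (0 : ℝ) < (m : ℝ) - n := sub_pos.2 (by exact_mod_cast hnm)
  have hMn := (hM n).le
  refine ContinuousLinearMap.opNorm_le_bound _ (by positivity) fun x => ?_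
  have hw := pow_le_factorial_mul_multichooseWeight k (Nat.sub_ne_zero_of_lt hnm)
  rw [Nat.cast_sub hnm.le] at hw
  have h := ((memC00_weightedOrbit_multichooseWeight hsurj n x k).nnorm_le_cnorm m).trans
    (cnorm_weightedOrbit_multichooseWeight_le hα0 hc.le hbd hsurj hinv n x k)
  rw [nnorm_weightedOrbit] at h
  have key : ‖evol A n m x‖ * ((m : ℝ) - n) ^ k ≤
      (c * (Real.exp α - 1) + 1) * (c ^ k * k.factorial) * M n * ‖x‖ :=
    calc ‖evol A n m x‖ * ((m : ℝ) - n) ^ k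
        ≤ nnorm A α m (evol A n m x) * (k.factorial * |multichooseWeight k (m - n)|) := by
          refine mul_le_mul (norm_le_nnorm hbd m _) (hw.trans ?_) (by positivity)
            (nnorm_nonneg' ..)
          gcongr
          exact le_abs_self _
      _ = k.factorial * (|multichooseWeight k (m - n)| * nnorm A α m (evol A n m x)) := by ring
      _ ≤ k.factorial * (c ^ k * ((c * (Real.exp α - 1) + 1) * (M n * ‖x‖))) := by
          refine mul_le_mul_of_nonneg_left (h.trans ?_) (by positivity)
          gcongr
          exact nnorm_le hbd n x
      _ = _ := by ring
  rw [div_mul_eq_mul_div, div_mul_eq_mul_div]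
  exact (le_div_iff₀ (by positivity)).2 key
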